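/- arXiv:1610.06820 — 3 statements merged into one kernel-verified Lean document; each statement's English description precedes it below -/
import Mathlib

section
/- Let m ≥ 1 be an integer, 0 < R₁ < R₂, Ω = B_{R₂} \ \bar{B}_{R₁} ⊂ ℝ^{2m}, and Λ > 0. Fix k ∈ ℕ. Let φ ∈ C^{2m}(Ω̄) be radially symmetric with φ ≤ 0, and let V : Ω → ℝ be radially symmetric measurable with 0 ≤ V ≤ b and ∫_Ω V dx ≥ a > 0. Let G : {(x,y) ∈ Ω̄×Ω̄ : x ≠ y} → ℝ be a function satisfying, with some constant C_G > 0, the Green-function bounds −C_G ≤ G(x,y) ≤ γ_{2m}^{−1} log(1/|x−y|) + C_G for all x ≠ y. For v ∈ C⁰_rad(Ω̄) define c_v ∈ ℝ by ∫_Ω V e^{2m(v + c_v)} dx = Λ and T_k(v)(x) := ∫_Ω G(x,y) V(y) e^{2m(v(y)+c_v)} dy + k φ(x). Then there exists M > 0 such that every pair (v,t) ∈ C⁰_rad(Ω̄) × (0,1] satisfying v = t T_k(v) obeys ‖v‖_{C⁰(Ω̄)} ≤ M. -/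
noncomputable section

open MeasureTheory Real Filter Topology Metric Set Bornology

/-- Euclidean space `ℝ^{2m}`. -/
abbrev Euc (m : ℕ) : Type := EuclideanSpace ℝ (Fin (2*m))

/-- Pointwise Laplacian `Δ f (x) = ∑ ∂²f/∂xᵢ²`. -/
def lap {m : ℕ} (f : Euc m → ℝ) (x : Euc m) : ℝ :=
  ∑ i : Fin (2*m),
    fderiv ℝ (fun y => fderiv ℝ f y (EuclideanSpace.single i (1:ℝ))) x
      (EuclideanSpace.single i (1:ℝ))

/-- `(−Δ)^j f`, pointwise. -/
def negLapPow {m : ℕ} (j : ℕ) (f : Euc m → ℝ) : Euc m → ℝ :=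
  (fun g x => -(lap g x))^[j] f

/-- Smooth test functions compactly supported inside `Ω`. -/
def IsTestOn {m : ℕ} (Ω : Set (Euc m)) (ψ : Euc m → ℝ) : Prop :=
  ContDiff ℝ (⊤ : ℕ∞) ψ ∧ HasCompactSupport ψ ∧ tsupport ψ ⊆ Ω

/-- `u` solves `(−Δ)^m u = V e^{2mu}` on `Ω` in the distributional sense. -/
def SolvesQ {m : ℕ} (Ω : Set (Euc m)) (V u : Euc m → ℝ) : Prop :=
  ∀ ψ : Euc m → ℝ, IsTestOn Ω ψ →
    ∫ x in Ω, u x * negLapPow m ψ x = ∫ x in Ω, V x * Real.exp ((2*m : ℝ) * u x) * ψ x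

/-- Volume of the standard unit `n`-sphere: `2 π^{(n+1)/2} / Γ((n+1)/2)`. -/
def sphereVol (n : ℕ) : ℝ :=
  2 * Real.pi ^ (((n : ℝ) + 1)/2) / Real.Gamma (((n : ℝ) + 1)/2)

/-- `Λ₁ = (2m−1)! vol(S^{2m})`. -/
def Lambda1 (m : ℕ) : ℝ := (Nat.factorial (2*m - 1) : ℝ) * sphereVol (2*m)

/-- `γ_{2m} = Λ₁/2`. -/
def gamma2m (m : ℕ) : ℝ := Lambda1 m / 2

/-- The class `K(Ω,∅)`: smooth, nonpositive, not identically zero, `Δ^m φ ≡ 0` on `Ω`. -/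
def memK {m : ℕ} (Ω : Set (Euc m)) (φ : Euc m → ℝ) : Prop :=
  ContDiffOn ℝ (⊤ : ℕ∞) φ Ω ∧ (∀ x ∈ Ω, φ x ≤ 0) ∧ (∃ x ∈ Ω, φ x ≠ 0) ∧
    ∀ x ∈ Ω, negLapPow m φ x = 0

/-- `S_φ = {x ∈ Ω : φ(x) = 0}`. -/
def Sphi {m : ℕ} (Ω : Set (Euc m)) (φ : Euc m → ℝ) : Set (Euc m) :=
  {x | x ∈ Ω ∧ φ x = 0}

/-- `S_φ^* = S_φ ∪ {x ∈ ∂Ω : lim_{Ω ∋ y → x} φ(y) = 0}`. -/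
def SphiStar {m : ℕ} (Ω : Set (Euc m)) (φ : Euc m → ℝ) : Set (Euc m) :=
  Sphi Ω φ ∪ {x | x ∈ frontier Ω ∧ Tendsto φ (𝓝[Ω] x) (𝓝 0)}

/-- `u_k → +∞` locally uniformly on `S`. -/
def LocUnifTop {m : ℕ} (u : ℕ → Euc m → ℝ) (S : Set (Euc m)) : Prop :=
  ∀ K : Set (Euc m), K ⊆ S → IsCompact K → ∀ C : ℝ,
    ∀ᶠ k in atTop, ∀ x ∈ K, C ≤ u k x

/-- `u_k → −∞` locally uniformly on `S`. -/
def LocUnifBot {m : ℕ} (u : ℕ → Euc m → ℝ) (S : Set (Euc m)) : Prop :=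
  ∀ K : Set (Euc m), K ⊆ S → IsCompact K → ∀ C : ℝ,
    ∀ᶠ k in atTop, ∀ x ∈ K, u k x ≤ C

/-- A function is radially symmetric if it depends only on the norm. -/
def Radial {m : ℕ} (f : Euc m → ℝ) : Prop := ∀ x y : Euc m, ‖x‖ = ‖y‖ → f x = f y

/-- Circle-average bound for the logarithmic kernel in the plane. -/
lemma lintegral_circle_log (r D : ℝ) (hr : 0 < r) (a : ℂ)
    (hD : ∀ θ, ‖circleMap 0 r θ - a‖ ≤ D) (hD0 : 0 < D) :
    ∫⁻ θ in Ioc 0 (2 * π), ENNReal.ofReal (Real.log D - Real.log ‖circleMap 0 r θ - a‖)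
      ≤ ENNReal.ofReal (2 * π * Real.log (D / r)) := by
  have hint : IntervalIntegrable (fun θ : ℝ => Real.log ‖circleMap 0 r θ - a‖) volume 0 (2 * π) :=
    circleIntegrable_log_norm_sub_const (c := 0) (a := a) r
  have havg := circleAverage_log_norm_sub_const_eq_log_radius_add_posLog (c := 0) (a := a) hr.ne'
  rw [Real.circleAverage_def, smul_eq_mul] at havg
  have hpi : 0 < 2 * π := by positivity
  have h1 : Real.log r * (2 * π) ≤ ∫ θ in 0..2 * π, Real.log ‖circleMap 0 r θ - a‖ := by
    have h2 : Real.log r ≤ (2 * π)⁻¹ * ∫ θ in 0..2 * π, Real.log ‖circleMap 0 r θ - a‖ := by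
      rw [havg]
      have := Real.posLog_nonneg (x := r⁻¹ * ‖0 - a‖)
      linarith
    rw [inv_mul_eq_div, le_div_iff₀ hpi] at h2
    exact h2
  have hint2 : IntervalIntegrable
      (fun θ : ℝ => Real.log D - Real.log ‖circleMap 0 r θ - a‖) volume 0 (2 * π) :=
    intervalIntegrable_const.sub hint
  rw [intervalIntegrable_iff_integrableOn_Ioc_of_le hpi.le] at hint2
  have hnn : ∀ᵐ θ ∂(volume.restrict (Ioc 0 (2 * π))),
      0 ≤ Real.log D - Real.log ‖circleMap 0 r θ - a‖ := by
    have : (circleMap 0 r ⁻¹' {a}).Countable := (countable_singleton _).preimage_circleMap 0 hr.ne'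
    filter_upwards [ae_restrict_of_ae (this.ae_notMem volume)] with θ hθ
    have hθ' : circleMap 0 r θ ≠ a := hθ
    have : 0 < ‖circleMap 0 r θ - a‖ := norm_pos_iff.2 (sub_ne_zero.2 hθ')
    linarith [Real.log_le_log this (hD θ)]
  rw [← ofReal_integral_eq_lintegral_ofReal hint2 hnn]
  apply ENNReal.ofReal_le_ofReal
  rw [← intervalIntegral.integral_of_le hpi.le, intervalIntegral.integral_sub
    intervalIntegrable_const hint, intervalIntegral.integral_const, Real.log_div hD0.ne' hr.ne']
  simp only [smul_eq_mul]
  linarith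

/-- Projection on two coordinates. -/
def projC {m : ℕ} (i j : Fin (2*m)) (y : Euc m) : ℂ := ⟨y i, y j⟩

/-- Embedding of the plane. -/
def embC {m : ℕ} (i j : Fin (2*m)) (z : ℂ) : Euc m :=
  EuclideanSpace.single i z.re + EuclideanSpace.single j z.im

lemma norm_projC {m : ℕ} {i j : Fin (2*m)} (hij : i ≠ j) (y : Euc m) : ‖projC i j y‖ ≤ ‖y‖ := by
  apply le_of_sq_le_sq _ (norm_nonneg _)
  rw [EuclideanSpace.norm_sq_eq, Complex.sq_norm, Complex.normSq_apply]
  have : ∑ l ∈ ({i, j} : Finset (Fin (2*m))), ‖y l‖ ^ 2 ≤ ∑ l, ‖y l‖ ^ 2 :=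
    Finset.sum_le_sum_of_subset_of_nonneg (Finset.subset_univ _) (fun _ _ _ => by positivity)
  rw [Finset.sum_pair hij] at this
  simp only [Real.norm_eq_abs, sq_abs] at this ⊢
  simp only [projC]
  nlinarith

lemma norm_embC {m : ℕ} {i j : Fin (2*m)} (hij : i ≠ j) (z : ℂ) : ‖(embC i j z : Euc m)‖ = ‖z‖ := by
  rw [← sq_eq_sq₀ (norm_nonneg _) (norm_nonneg _), embC, norm_add_sq_real, Complex.sq_norm,
    Complex.normSq_apply]
  simp [EuclideanSpace.inner_single_left, hij]
  ring

lemma projC_embC_sub {m : ℕ} {i j : Fin (2*m)} (hij : i ≠ j) (z : ℂ) (y : Euc m) :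
    projC i j (embC i j z - y) = z - projC i j y := by
  apply Complex.ext <;> simp [projC, embC, hij, hij.symm]

lemma key_log {m : ℕ} (hm : 1 ≤ m) (r R₂ : ℝ) (hr : 0 < r) (hrR : r ≤ R₂)
    (Ω : Set (Euc m)) (hΩm : MeasurableSet Ω) (hΩ : Ω ⊆ ball 0 R₂)
    (w : Euc m → ℝ) (hw : IntegrableOn w Ω) (hw0 : ∀ y ∈ Ω, 0 ≤ w y) :
    ∃ z : Euc m, ‖z‖ = r ∧
      IntegrableOn (fun y => (Real.log (2 * R₂) - Real.log ‖z - y‖) * w y) Ω ∧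
      ∫ y in Ω, (Real.log (2 * R₂) - Real.log ‖z - y‖) * w y
        ≤ Real.log (2 * R₂ / r) * (∫ y in Ω, w y) + 1 := by
  let i : Fin (2*m) := ⟨0, by omega⟩
  let j : Fin (2*m) := ⟨1, by omega⟩
  have hij : i ≠ j := by simp [i, j]
  let ξ : ℝ → Euc m := fun θ => embC i j (circleMap 0 r θ)
  have hξ : ∀ θ, ‖ξ θ‖ = r := fun θ => by
    simp only [ξ, norm_embC hij, norm_circleMap_zero, abs_of_pos hr]
  have hξc : Continuous ξ := by
    have h1 : Continuous (fun θ => (circleMap 0 r θ).re) :=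
      Complex.continuous_re.comp (continuous_circleMap 0 r)
    have h2 : Continuous (fun θ => (circleMap 0 r θ).im) :=
      Complex.continuous_im.comp (continuous_circleMap 0 r)
    have e : ξ = fun θ => (circleMap 0 r θ).re • (EuclideanSpace.single i (1:ℝ) : Euc m)
        + (circleMap 0 r θ).im • (EuclideanSpace.single j (1:ℝ) : Euc m) := by
      funext θ
      ext l
      simp [ξ, embC]
    rw [e]
    fun_prop
  have hL : 0 ≤ Real.log (2 * R₂ / r) := by
    apply Real.log_nonneg
    rw [le_div_iff₀ hr]; linarith
  have hW : 0 ≤ ∫ y in Ω, w y := setIntegral_nonneg hΩm hw0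
  let f : ℝ → Euc m → ENNReal := fun θ y =>
    ENNReal.ofReal (Real.log (2 * R₂) - Real.log ‖ξ θ - y‖) * ENNReal.ofReal (w y)
  have hfm : AEMeasurable (Function.uncurry f)
      ((volume.restrict (Ioc 0 (2 * π))).prod (volume.restrict Ω)) := by
    change AEMeasurable (fun p : ℝ × Euc m =>
      ENNReal.ofReal (Real.log (2 * R₂) - Real.log ‖ξ p.1 - p.2‖) * ENNReal.ofReal (w p.2)) _
    apply AEMeasurable.fun_mul
    · have : Measurable (fun p : ℝ × Euc m => ‖ξ p.1 - p.2‖) :=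
        ((hξc.comp continuous_fst).sub continuous_snd).norm.measurable
      exact (measurable_const.sub (Real.measurable_log.comp this)).ennreal_ofReal.aemeasurable
    · exact hw.aestronglyMeasurable.aemeasurable.ennreal_ofReal.comp_snd
  have hswap := lintegral_lintegral_swap hfm
  have hinner : ∀ y ∈ Ω, ∫⁻ θ in Ioc 0 (2 * π), f θ y
      ≤ ENNReal.ofReal (2 * π * Real.log (2 * R₂ / r)) * ENNReal.ofReal (w y) := by
    intro y hy
    have hyn : ‖y‖ < R₂ := by simpa using hΩ hy
    simp only [f]
    rw [lintegral_mul_const' _ _ ENNReal.ofReal_ne_top]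
    gcongr
    refine le_trans ?_ (lintegral_circle_log r (2 * R₂) hr (projC i j y) ?_ (by linarith))
    · apply lintegral_mono_ae
      have : (circleMap 0 r ⁻¹' {projC i j y}).Countable :=
        (countable_singleton _).preimage_circleMap 0 hr.ne'
      filter_upwards [ae_restrict_of_ae (this.ae_notMem volume)] with θ hθ
      have hθ' : circleMap 0 r θ ≠ projC i j y := hθ
      have hpos : 0 < ‖circleMap 0 r θ - projC i j y‖ := norm_pos_iff.2 (sub_ne_zero.2 hθ')
      apply ENNReal.ofReal_le_ofReal
      have h3 := norm_projC hij (ξ θ - y)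
      rw [projC_embC_sub hij] at h3
      linarith [Real.log_le_log hpos h3]
    · intro θ
      refine (norm_sub_le _ _).trans ?_
      rw [norm_circleMap_zero, abs_of_pos hr]
      linarith [norm_projC hij y]
  have htot : ∫⁻ θ in Ioc 0 (2 * π), ∫⁻ y in Ω, f θ y
      ≤ ENNReal.ofReal (2 * π * (Real.log (2 * R₂ / r) * ∫ y in Ω, w y)) := by
    rw [hswap]
    refine (setLIntegral_mono_ae' hΩm (ae_of_all _ hinner)).trans ?_
    rw [lintegral_const_mul' _ _ ENNReal.ofReal_ne_top, ← ofReal_integral_eq_lintegral_ofReal hw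
      ((ae_restrict_iff' hΩm).2 (ae_of_all _ hw0)), ← ENNReal.ofReal_mul (by positivity)]
    apply le_of_eq
    congr 1
    ring
  set B : ℝ := Real.log (2 * R₂ / r) * ∫ y in Ω, w y with hB
  have hB0 : 0 ≤ B := mul_nonneg hL hW
  obtain ⟨θ, hθ⟩ : ∃ θ, ∫⁻ y in Ω, f θ y ≤ ENNReal.ofReal (B + 1) := by
    by_contra! hcon
    have h4 : ∫⁻ _ in Ioc 0 (2 * π), ENNReal.ofReal (B + 1)
        ≤ ∫⁻ θ in Ioc 0 (2 * π), ∫⁻ y in Ω, f θ y := lintegral_mono (fun θ => (hcon θ).le)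
    have h5 := h4.trans htot
    rw [setLIntegral_const, Real.volume_Ioc, ← ENNReal.ofReal_mul (by linarith),
      ENNReal.ofReal_le_ofReal_iff (by positivity)] at h5
    nlinarith [Real.pi_pos]
  have hg0 : ∀ᵐ y ∂(volume.restrict Ω),
      0 ≤ (Real.log (2 * R₂) - Real.log ‖ξ θ - y‖) * w y := by
    haveI : Nonempty (Fin (2*m)) := ⟨i⟩
    filter_upwards [ae_restrict_mem hΩm,
      ae_restrict_of_ae ((countable_singleton (ξ θ)).ae_notMem volume)] with y hy hne
    have hyn : ‖y‖ < R₂ := by simpa using hΩ hy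
    have hpos : 0 < ‖ξ θ - y‖ := norm_pos_iff.2 (sub_ne_zero.2 (fun h => hne h.symm))
    have hle : ‖ξ θ - y‖ ≤ 2 * R₂ := by
      refine (norm_sub_le _ _).trans ?_
      rw [hξ]; linarith
    exact mul_nonneg (by linarith [Real.log_le_log hpos hle]) (hw0 y hy)
  have hgm : AEStronglyMeasurable
      (fun y => (Real.log (2 * R₂) - Real.log ‖ξ θ - y‖) * w y) (volume.restrict Ω) := by
    apply AEStronglyMeasurable.mul _ hw.aestronglyMeasurable
    have : Measurable (fun y : Euc m => ‖ξ θ - y‖) :=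
        (continuous_const.sub continuous_id).norm.measurable
    exact (measurable_const.sub (Real.measurable_log.comp this)).aestronglyMeasurable
  have heq : ∫⁻ y in Ω, ENNReal.ofReal ((Real.log (2 * R₂) - Real.log ‖ξ θ - y‖) * w y)
      = ∫⁻ y in Ω, f θ y := by
    apply setLIntegral_congr_fun hΩm
    intro y hy
    exact ENNReal.ofReal_mul' (hw0 y hy)
  refine ⟨ξ θ, hξ θ, ⟨hgm, ?_⟩, ?_⟩
  · rw [hasFiniteIntegral_iff_ofReal hg0, heq]
    exact hθ.trans_lt ENNReal.ofReal_lt_top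
  · rw [integral_eq_lintegral_of_nonneg_ae hg0 hgm, heq]
    exact ENNReal.toReal_le_of_le_ofReal (by linarith) hθ

lemma gamma2m_pos (m : ℕ) : 0 < gamma2m m := by
  unfold gamma2m Lambda1 sphereVol
  have : 0 < Real.Gamma (((2 * m : ℕ) + 1 : ℝ) / 2) := Real.Gamma_pos_of_pos (by positivity)
  positivity

/-- **Lemma (a priori bound for the fixed point equation on the annulus).**
On `Ω = B_{R₂} \ B̄_{R₁}`, with `φ ∈ C^{2m}(Ω̄)` radial nonpositive, `V` radial measurable
with `0 ≤ V ≤ b` and `∫_Ω V ≥ a > 0`, a kernel `G` with Green-function bounds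
`−C_G ≤ G(x,y) ≤ γ_{2m}⁻¹ log(1/|x−y|) + C_G`, and `c_v` normalised by
`∫_Ω V e^{2m(v+c_v)} = Λ`, every solution of `v = t T_k(v)` with `t ∈ (0,1]` satisfies
a uniform bound `‖v‖_{C⁰(Ω̄)} ≤ M`. -/
theorem statement13 (m : ℕ) (hm : 1 ≤ m) (R₁ R₂ : ℝ) (hR₁ : 0 < R₁) (hR : R₁ < R₂)
    (Ω : Set (Euc m)) (hΩ : Ω = ball (0 : Euc m) R₂ \ closedBall (0 : Euc m) R₁)
    (Λ : ℝ) (hΛpos : 0 < Λ) (k : ℕ)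
    (φ : Euc m → ℝ) (hφreg : ContDiffOn ℝ (2*m : ℕ) φ (closure Ω)) (hφrad : Radial φ)
    (hφle : ∀ x ∈ closure Ω, φ x ≤ 0)
    (V : Euc m → ℝ) (hVmeas : Measurable V) (hVrad : Radial V)
    (b : ℝ) (hVbd : ∀ x ∈ Ω, 0 ≤ V x ∧ V x ≤ b)
    (a : ℝ) (ha : 0 < a) (hVint : a ≤ ∫ x in Ω, V x)
    (G : Euc m → Euc m → ℝ) (C_G : ℝ) (hCG : 0 < C_G)
    (hG : ∀ x ∈ closure Ω, ∀ y ∈ closure Ω, x ≠ y →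
      -C_G ≤ G x y ∧ G x y ≤ (1 / gamma2m m) * Real.log (1 / ‖x - y‖) + C_G)
    (c : (Euc m → ℝ) → ℝ)
    (hc : ∀ v : Euc m → ℝ, ContinuousOn v (closure Ω) → Radial v →
      ∫ x in Ω, V x * Real.exp ((2*m : ℝ) * (v x + c v)) = Λ) :
    ∃ M : ℝ, 0 < M ∧
      ∀ (v : Euc m → ℝ) (t : ℝ), ContinuousOn v (closure Ω) → Radial v →
        t ∈ Set.Ioc (0 : ℝ) 1 →
        (∀ x ∈ closure Ω, v x =
          t * ((∫ y in Ω, G x y * (V y * Real.exp ((2*m : ℝ) * (v y + c v))))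
                + (k : ℝ) * φ x)) →
        ∀ x ∈ closure Ω, |v x| ≤ M := by
  have hΩm : MeasurableSet Ω := by
    rw [hΩ]; exact measurableSet_ball.diff measurableSet_closedBall
  have hΩb : Ω ⊆ ball 0 R₂ := by rw [hΩ]; exact sdiff_subset
  have hclb : closure Ω ⊆ closedBall 0 R₂ :=
    (closure_mono hΩb).trans closure_ball_subset_closedBall
  have hcla : ∀ x ∈ closure Ω, R₁ ≤ ‖x‖ := by
    have hcl : IsClosed {x : Euc m | R₁ ≤ ‖x‖} := isClosed_le continuous_const continuous_norm
    have hsub : Ω ⊆ {x : Euc m | R₁ ≤ ‖x‖} := by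
      intro x hx
      rw [hΩ] at hx
      have h := hx.2
      rw [mem_closedBall_zero_iff, not_le] at h
      exact h.le
    exact fun x hx => closure_minimal hsub hcl hx
  have hclrad : ∀ x ∈ closure Ω, ∀ z : Euc m, ‖z‖ = ‖x‖ → z ∈ closure Ω := by
    intro x hx z hz
    let e := (ℝ ∙ (x - z))ᗮ.reflection
    have he : e x = z := Submodule.reflection_sub hz.symm
    rw [← he]
    refine map_mem_closure e.continuous hx ?_
    intro y hy
    rw [hΩ] at hy ⊢
    simpa using hy
  have hcomp : IsCompact (closure Ω) := (isCompact_closedBall _ _).of_isClosed_subset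
    isClosed_closure hclb
  obtain ⟨B, hBφ⟩ := hcomp.exists_bound_of_continuousOn hφreg.continuousOn
  have hγ : 0 ≤ 1 / gamma2m m := (one_div_pos.2 (gamma2m_pos m)).le
  set g := 1 / gamma2m m with hg
  set L := Real.log (2 * R₂ / R₁) with hL
  have hL0 : 0 ≤ L := Real.log_nonneg (by rw [le_div_iff₀ hR₁]; linarith)
  set U := g * (L * Λ + 1) + (g * |Real.log (2 * R₂)| + C_G) * Λ with hU
  have hU0 : 0 ≤ U := by positivity
  have hUC : C_G * Λ ≤ U := by
    have : 0 ≤ g * (L * Λ + 1) + g * |Real.log (2 * R₂)| * Λ := by positivity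
    rw [hU]; linarith
  refine ⟨U + k * |B| + 1, by positivity, ?_⟩
  intro v t hv hvr ht hfix x hx
  set w : Euc m → ℝ := fun y => V y * Real.exp ((2*m : ℝ) * (v y + c v)) with hwdef
  have hwΛ : ∫ y in Ω, w y = Λ := hc v hv hvr
  have hw0 : ∀ y ∈ Ω, 0 ≤ w y := fun y hy => mul_nonneg (hVbd y hy).1 (Real.exp_pos _).le
  have hwi : IntegrableOn w Ω := by
    by_contra hn
    rw [integral_undef hn] at hwΛ
    linarith
  have hne : ∀ z : Euc m, ∀ᵐ y ∂(volume.restrict Ω), y ∈ Ω ∧ z ≠ y := by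
    intro z
    haveI : Nonempty (Fin (2*m)) := ⟨⟨0, by omega⟩⟩
    filter_upwards [ae_restrict_mem hΩm,
      ae_restrict_of_ae ((countable_singleton z).ae_notMem volume)] with y hy hne
    exact ⟨hy, fun h => hne h.symm⟩
  have hkφ : ∀ z ∈ closure Ω, |(k : ℝ) * φ z| ≤ k * |B| := by
    intro z hz
    rw [abs_mul, Nat.abs_cast]
    have := (hBφ z hz).trans (le_abs_self B)
    rw [Real.norm_eq_abs] at this
    gcongr
  have hlow : -U ≤ ∫ y in Ω, G x y * w y := by
    by_cases hi : IntegrableOn (fun y => G x y * w y) Ω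
    · have h1 : ∫ y in Ω, (-C_G) * w y ≤ ∫ y in Ω, G x y * w y := by
        apply integral_mono_ae (hwi.const_mul _) hi
        filter_upwards [hne x] with y hy
        exact mul_le_mul_of_nonneg_right (hG x hx y (subset_closure hy.1) hy.2).1 (hw0 y hy.1)
      rw [integral_const_mul, hwΛ] at h1
      linarith
    · rw [integral_undef hi]; linarith
  obtain ⟨z, hzx, hzi, hzb⟩ := key_log hm ‖x‖ R₂ (hR₁.trans_le (hcla x hx))
    (by simpa using hclb hx) Ω hΩm hΩb w hwi hw0
  have hzc : z ∈ closure Ω := hclrad x hx z hzx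
  have hup : ∫ y in Ω, G z y * w y ≤ U := by
    by_cases hi : IntegrableOn (fun y => G z y * w y) Ω
    · have hI : IntegrableOn (fun y => g * ((Real.log (2 * R₂) - Real.log ‖z - y‖) * w y)
          + (g * |Real.log (2 * R₂)| + C_G) * w y) Ω :=
        (hzi.const_mul g).add (hwi.const_mul _)
      have h1 : ∫ y in Ω, G z y * w y ≤
          ∫ y in Ω, (g * ((Real.log (2 * R₂) - Real.log ‖z - y‖) * w y)
          + (g * |Real.log (2 * R₂)| + C_G) * w y) := by
        apply integral_mono_ae hi hI
        filter_upwards [hne z] with y hy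
        have h2 := (hG z hzc y (subset_closure hy.1) hy.2).2
        rw [one_div ‖z - y‖, Real.log_inv] at h2
        have h3 : 0 ≤ g * (|Real.log (2 * R₂)| + Real.log (2 * R₂)) :=
          mul_nonneg hγ (by linarith [neg_abs_le (Real.log (2 * R₂))])
        have h4 : G z y ≤ g * (Real.log (2 * R₂) - Real.log ‖z - y‖)
          + (g * |Real.log (2 * R₂)| + C_G) := by linarith
        have h5 := mul_le_mul_of_nonneg_right h4 (hw0 y hy.1)
        linarith
      rw [integral_add (hzi.const_mul g) (hwi.const_mul _), integral_const_mul,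
        integral_const_mul, hwΛ] at h1
      rw [hwΛ] at hzb
      have hx1 := hcla x hx
      have h6 : Real.log (2 * R₂ / ‖x‖) ≤ L := by
        apply Real.log_le_log
        · exact div_pos (by linarith) (by linarith)
        · exact div_le_div_of_nonneg_left (by linarith) hR₁ hx1
      have h7 : Real.log (2 * R₂ / ‖x‖) * Λ ≤ L * Λ := mul_le_mul_of_nonneg_right h6 hΛpos.le
      have h8 := mul_le_mul_of_nonneg_left (hzb.trans (by linarith : _ ≤ L * Λ + 1)) hγ
      linarith
    · rw [integral_undef hi]; exact hU0
  have hvz : v x = v z := hvr x z hzx.symm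
  have e1 := hfix x hx
  have e2 := hfix z hzc
  have a1 := abs_le.1 (hkφ x hx)
  have a2 := abs_le.1 (hkφ z hzc)
  have hkB : (0:ℝ) ≤ k * |B| := by positivity
  rw [abs_le]
  constructor
  · rw [e1]
    nlinarith [ht.1, ht.2, mul_nonneg ht.1.le (show 0 ≤ (∫ y in Ω, G x y * w y) + k * φ x
      + (U + k * |B|) by linarith), mul_nonneg (sub_nonneg.2 ht.2) (add_nonneg hU0 hkB)]
  · rw [hvz, e2]
    nlinarith [ht.1, ht.2, mul_nonneg ht.1.le (show 0 ≤ (U + k * |B|) -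
      ((∫ y in Ω, G z y * w y) + k * φ z) by linarith),
      mul_nonneg (sub_nonneg.2 ht.2) (add_nonneg hU0 hkB)]
end
end

section
/- Let m ≥ 1 be an integer and let u₀ ∈ C^∞(ℝ^{2m}) satisfy u₀(x) = log|x| for |x| ≥ 2. Then (−Δ)^m u₀ vanishes outside B₂ and ∫_{ℝ^{2m}} (−Δ)^m u₀ dx = −γ_{2m}, where γ_{2m} = (2m−1)!·vol(S^{2m})/2. -/
noncomputable section

open MeasureTheory Real Filter Topology Metric Set Bornology

lemma const_eq (k : ℕ) :
    gamma2m (k+1) = 2 * 4^k * (Nat.factorial k) * Real.pi^(k+1) := by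
  unfold gamma2m Lambda1 sphereVol
  have h1 : (((2*(k+1) : ℕ) : ℝ) + 1)/2 = ((k+1 : ℕ) : ℝ) + 1/2 := by push_cast; ring
  rw [h1, Real.Gamma_nat_add_half, Real.rpow_add Real.pi_pos, Real.rpow_natCast,
    ← Real.sqrt_eq_rpow]
  have h2 : 2*(k+1) - 1 = 2*k+1 := by omega
  rw [h2, Nat.factorial_eq_mul_doubleFactorial, Nat.doubleFactorial_two_mul]
  have h3 : ((Nat.doubleFactorial (2*k+1) : ℕ) : ℝ) ≠ 0 := by
    exact_mod_cast (Nat.doubleFactorial_pos _).ne'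
  have h4 : √Real.pi ≠ 0 := (Real.sqrt_pos.2 Real.pi_pos).ne'
  push_cast
  have h5 : (4:ℝ)^k = 2^k*2^k := by rw [← mul_pow]; norm_num
  rw [h5]
  field_simp
  ring

lemma hasF_pow {m : ℕ} (k : ℕ) (x : Euc m) (hx : x ≠ 0) :
    HasFDerivAt (fun y : Euc m => ((‖y‖^2)⁻¹)^k)
      ((-2 * k * ((‖x‖^2)⁻¹)^(k+1)) • innerSL ℝ x) x := by
  have hs : HasFDerivAt (fun y : Euc m => ‖y‖^2) (2 • innerSL ℝ x) x :=
    (hasStrictFDerivAt_norm_sq x).hasFDerivAt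
  have hn : ‖x‖^2 ≠ 0 := by positivity
  have hd : HasDerivAt (fun s : ℝ => (s⁻¹)^k) (k * ((‖x‖^2)⁻¹)^(k-1) * (-((‖x‖^2)^2)⁻¹)) (‖x‖^2) :=
    (hasDerivAt_inv hn).fun_pow k
  have := hd.comp_hasFDerivAt x hs
  refine this.congr_fderiv ?_
  ext v
  simp
  rcases k with _ | k
  · simp
  · simp only [Nat.add_sub_cancel]
    push_cast
    field_simp
    ring

lemma lap_of_grad {m : ℕ} (g : Euc m → ℝ) (a : ℝ) (j : ℕ)
    (hg : ∀ x : Euc m, 2 < ‖x‖ → HasFDerivAt g ((a * ((‖x‖^2)⁻¹)^(j+1)) • innerSL ℝ x) x)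
    (x : Euc m) (hx : 2 < ‖x‖) :
    lap g x = a * (2*m - 2*(j+1)) * ((‖x‖^2)⁻¹)^(j+1) := by
  have hx0 : x ≠ 0 := by rintro rfl; simp at hx; linarith
  have hn : ‖x‖^2 ≠ 0 := by positivity
  have key : ∀ i : Fin (2*m),
      fderiv ℝ (fun y => fderiv ℝ g y (EuclideanSpace.single i (1:ℝ))) x
      (EuclideanSpace.single i (1:ℝ)) =
      a * ((‖x‖^2)⁻¹)^(j+1) - 2*(j+1) * a * ((‖x‖^2)⁻¹)^(j+2) * (x i)^2 := by
    intro i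
    have he : (fun y => fderiv ℝ g y (EuclideanSpace.single i (1:ℝ))) =ᶠ[𝓝 x]
        fun y => (a * ((‖y‖^2)⁻¹)^(j+1)) * (EuclideanSpace.proj i : Euc m →L[ℝ] ℝ) y := by
      have : ∀ᶠ y : Euc m in 𝓝 x, 2 < ‖y‖ := continuous_norm.continuousAt.eventually (lt_mem_nhds hx)
      filter_upwards [this] with y hy
      rw [(hg y hy).fderiv]
      simp [EuclideanSpace.inner_single_right]
    rw [he.fderiv_eq]
    have h1 := ((hasF_pow (j+1) x hx0).const_mul a).mul
      ((EuclideanSpace.proj i : Euc m →L[ℝ] ℝ).hasFDerivAt (x := x))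
    have h2 := h1.fderiv
    erw [h2]
    simp [EuclideanSpace.inner_single_right]
    ring
  unfold lap
  rw [Finset.sum_congr rfl (fun i _ => key i), Finset.sum_sub_distrib, ← Finset.mul_sum, ← Finset.mul_sum,
    ← EuclideanSpace.real_norm_sq_eq]
  simp
  field_simp
  ring

lemma contDiff_lap {m : ℕ} {g : Euc m → ℝ} (hg : ContDiff ℝ (⊤ : ℕ∞) g) :
    ContDiff ℝ (⊤ : ℕ∞) (fun x => lap g x) := by
  unfold lap
  refine ContDiff.sum fun i _ => ?_
  have h1 : ContDiff ℝ (⊤ : ℕ∞) (fun y => fderiv ℝ g y (EuclideanSpace.single i (1:ℝ))) :=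
    (hg.fderiv_right (by simp)).clm_apply contDiff_const
  exact (h1.fderiv_right (by simp)).clm_apply contDiff_const

lemma negLapPow_succ' {m : ℕ} (j : ℕ) (f : Euc m → ℝ) :
    negLapPow (j+1) f = fun x => -(lap (negLapPow j f) x) := by
  unfold negLapPow
  rw [Function.iterate_succ_apply']

lemma contDiff_negLapPow {m : ℕ} {g : Euc m → ℝ} (hg : ContDiff ℝ (⊤ : ℕ∞) g) (j : ℕ) :
    ContDiff ℝ (⊤ : ℕ∞) (negLapPow j g) := by
  induction j with
  | zero => simpa [negLapPow] using hg
  | succ j ih => rw [negLapPow_succ']; exact (contDiff_lap ih).neg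

lemma grad_negLapPow {m k : ℕ} (hk : m = k + 1) (u : Euc m → ℝ)
    (hu : ∀ x : Euc m, 2 ≤ ‖x‖ → u x = Real.log ‖x‖) (j : ℕ) (hj : j ≤ k) :
    ∀ x : Euc m, 2 < ‖x‖ → HasFDerivAt (negLapPow j u)
      (((4^j * (Nat.factorial j) * (Nat.descFactorial k j) : ℝ) * ((‖x‖^2)⁻¹)^(j+1))
        • innerSL ℝ x) x := by
  induction j with
  | zero =>
    intro x hx
    have hn : ‖x‖^2 ≠ 0 := by positivity
    have hs : HasFDerivAt (fun y : Euc m => ‖y‖^2) (2 • innerSL ℝ x) x :=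
      (hasStrictFDerivAt_norm_sq x).hasFDerivAt
    have h1 := (hs.log hn).const_mul (1/2 : ℝ)
    have he : negLapPow 0 u =ᶠ[𝓝 x] fun y => (1/2 : ℝ) * Real.log (‖y‖^2) := by
      have : ∀ᶠ y : Euc m in 𝓝 x, 2 < ‖y‖ := continuous_norm.continuousAt.eventually (lt_mem_nhds hx)
      filter_upwards [this] with y hy
      simp [negLapPow, hu y hy.le, Real.log_pow]
    refine (h1.congr_of_eventuallyEq he).congr_fderiv ?_
    ext v
    simp
    ring
  | succ j ih =>
    intro x hx
    have hx0 : x ≠ 0 := by rintro rfl; simp at hx; linarith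
    have ih' := ih (by omega)
    rw [negLapPow_succ']
    have he : (fun y => -(lap (negLapPow j u) y)) =ᶠ[𝓝 x]
        fun y => (-((4^j * (Nat.factorial j) * (Nat.descFactorial k j) : ℝ) * (2*m - 2*(j+1)))) *
          ((‖y‖^2)⁻¹)^(j+1) := by
      have : ∀ᶠ y : Euc m in 𝓝 x, 2 < ‖y‖ := continuous_norm.continuousAt.eventually (lt_mem_nhds hx)
      filter_upwards [this] with y hy
      rw [lap_of_grad _ _ j ih' y hy]
      ring
    refine (((hasF_pow (j+1) x hx0).const_mul _).congr_of_eventuallyEq he).congr_fderiv ?_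
    rw [smul_smul]
    congr 1
    rw [Nat.descFactorial_succ, Nat.factorial_succ]
    have : ((k - j : ℕ) : ℝ) = k - j := by rw [Nat.cast_sub (by omega)]
    push_cast
    have hm' : (m : ℝ) = k + 1 := by exact_mod_cast hk
    rw [this, hm']
    ring

def phi (t : ℝ) : ℝ := Real.smoothTransition (10 - t)

lemma phi_contDiff : ContDiff ℝ (⊤ : ℕ∞) phi :=
  Real.smoothTransition.contDiff.comp (contDiff_const.sub contDiff_id)

lemma phi_one {t : ℝ} (h : t ≤ 9) : phi t = 1 :=
  Real.smoothTransition.one_of_one_le (by linarith)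

lemma phi_zero {t : ℝ} (h : 10 ≤ t) : phi t = 0 :=
  Real.smoothTransition.zero_of_nonpos (by linarith)

lemma dphi_low {t : ℝ} (h : t < 9) : deriv phi t = 0 := by
  have : phi =ᶠ[𝓝 t] fun _ => 1 := by
    filter_upwards [gt_mem_nhds h] with s hs using phi_one hs.le
  rw [this.deriv_eq]; simp

lemma dphi_high {t : ℝ} (h : 10 < t) : deriv phi t = 0 := by
  have : phi =ᶠ[𝓝 t] fun _ => 0 := by
    filter_upwards [lt_mem_nhds h] with s hs using phi_zero hs.le
  rw [this.deriv_eq]; simp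

lemma integral_dphi : ∫ r in Ioi (0:ℝ), 2 * r * deriv phi (r^2) = -1 := by
  have hd : ∀ r : ℝ, HasDerivAt (fun r : ℝ => phi (r^2)) (2 * r * deriv phi (r^2)) r := by
    intro r
    have h1 : HasDerivAt phi (deriv phi (r^2)) (r^2) :=
      (phi_contDiff.differentiable (by simp) _).hasDerivAt
    have := HasDerivAt.comp (h₂ := phi) (h := fun r : ℝ => r^2) r h1 (hasDerivAt_pow 2 r)
    convert! this using 1
    simp; ring
  have hc : Continuous (fun r : ℝ => 2 * r * deriv phi (r^2)) := by
    have : Continuous (deriv phi) := phi_contDiff.continuous_deriv (by simp)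
    fun_prop
  have hcs : HasCompactSupport (fun r : ℝ => 2 * r * deriv phi (r^2)) := by
    refine HasCompactSupport.intro (isCompact_Icc (a := (-4:ℝ)) (b := 4)) ?_
    intro r hr
    have : 10 < r^2 := by
      by_contra hcon
      apply hr
      constructor <;> nlinarith
    rw [dphi_high this]; simp
  have hi : Integrable (fun r : ℝ => 2 * r * deriv phi (r^2)) := hc.integrable_of_hasCompactSupport hcs
  have := integral_Ioi_of_hasDerivAt_of_tendsto' (a := 0) (m := 0) (fun x _ => hd x)
    hi.integrableOn ?_
  · rw [this, phi_one (by norm_num)]; norm_num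
  · refine tendsto_const_nhds.congr' ?_
    filter_upwards [eventually_ge_atTop (4:ℝ)] with r hr
    rw [phi_zero (by nlinarith)]

lemma integral_lap {k : ℕ} (v : Euc (k+1) → ℝ) (hv : ContDiff ℝ (⊤ : ℕ∞) v) (a : ℝ)
    (hg : ∀ x : Euc (k+1), 2 < ‖x‖ → HasFDerivAt v ((a * ((‖x‖^2)⁻¹)^(k+1)) • innerSL ℝ x) x)
    (hl : ∀ x : Euc (k+1), 2 < ‖x‖ → lap v x = 0) :
    ∫ x, lap v x = a * (2 * Real.pi^(k+1) / Nat.factorial k) := by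
  set χ : Euc (k+1) → ℝ := fun x => phi (‖x‖^2) with hχ
  have hχs : ContDiff ℝ (⊤ : ℕ∞) χ := phi_contDiff.comp (contDiff_norm_sq ℝ)
  have hχc : HasCompactSupport χ := by
    refine HasCompactSupport.intro (isCompact_closedBall (0 : Euc (k+1)) 4) ?_
    intro x hx
    simp only [mem_closedBall, dist_zero_right, not_le] at hx
    exact phi_zero (by nlinarith)
  have hχd : ∀ x, HasFDerivAt χ ((2 * deriv phi (‖x‖^2)) • innerSL ℝ x) x := by
    intro x
    have hs : HasFDerivAt (fun y : Euc (k+1) => ‖y‖^2) (2 • innerSL ℝ x) x :=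
      (hasStrictFDerivAt_norm_sq x).hasFDerivAt
    have h1 : HasDerivAt phi (deriv phi (‖x‖^2)) (‖x‖^2) :=
      (phi_contDiff.differentiable (by simp) _).hasDerivAt
    refine (h1.comp_hasFDerivAt x hs).congr_fderiv ?_
    ext w; simp; ring
  have e1 : ∀ x, lap v x = lap v x * χ x := by
    intro x
    by_cases h : 2 < ‖x‖
    · rw [hl x h]; simp
    · have : χ x = 1 := phi_one (by nlinarith [norm_nonneg x])
      rw [this, mul_one]
  have hvi : ∀ i, ContDiff ℝ (⊤ : ℕ∞)
      (fun y => fderiv ℝ v y (EuclideanSpace.single i (1:ℝ))) := fun i =>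
    (hv.fderiv_right (by simp)).clm_apply contDiff_const
  have hvii : ∀ i, Continuous (fun x => fderiv ℝ
      (fun y => fderiv ℝ v y (EuclideanSpace.single i (1:ℝ))) x (EuclideanSpace.single i (1:ℝ))) :=
    fun i => (ContDiff.clm_apply (n := (⊤ : ℕ∞)) ((hvi i).fderiv_right (by simp))
      contDiff_const).continuous
  have hχi : ∀ i, Continuous (fun x => fderiv ℝ χ x (EuclideanSpace.single i (1:ℝ))) :=
    fun i => (ContDiff.clm_apply (n := (⊤ : ℕ∞)) (hχs.fderiv_right (by simp))
      contDiff_const).continuous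
  have hI1 : ∀ i, Integrable (fun x => fderiv ℝ
      (fun y => fderiv ℝ v y (EuclideanSpace.single i (1:ℝ))) x (EuclideanSpace.single i (1:ℝ)) * χ x) :=
    fun i => ((hvii i).mul hχs.continuous).integrable_of_hasCompactSupport hχc.mul_left
  have hI2 : ∀ i, Integrable (fun x => fderiv ℝ v x (EuclideanSpace.single i (1:ℝ)) *
      fderiv ℝ χ x (EuclideanSpace.single i (1:ℝ))) :=
    fun i => ((hvi i).continuous.mul (hχi i)).integrable_of_hasCompactSupport
      (HasCompactSupport.mul_left (hχc.fderiv_apply ℝ _))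
  have hI3 : ∀ i, Integrable (fun x => fderiv ℝ v x (EuclideanSpace.single i (1:ℝ)) * χ x) :=
    fun i => ((hvi i).continuous.mul hχs.continuous).integrable_of_hasCompactSupport hχc.mul_left
  have ibp : ∀ i, ∫ x, fderiv ℝ
      (fun y => fderiv ℝ v y (EuclideanSpace.single i (1:ℝ))) x (EuclideanSpace.single i (1:ℝ)) * χ x
      = - ∫ x, fderiv ℝ v x (EuclideanSpace.single i (1:ℝ)) *
      fderiv ℝ χ x (EuclideanSpace.single i (1:ℝ)) := by
    intro i
    have := integral_mul_fderiv_eq_neg_fderiv_mul_of_integrable (hI1 i) (hI2 i) (hI3 i)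
      (fun x _ => (hvi i).differentiable (by simp) x) (fun x _ => hχs.differentiable (by simp) x)
    linarith
  have e2 : ∫ x, lap v x = - ∫ x : Euc (k+1), (fun r : ℝ => 2 * a * ((r^2)⁻¹)^(k+1) * r^2 * deriv phi (r^2)) ‖x‖ := by
    have : ∫ x, lap v x = ∫ x, ∑ i, fderiv ℝ
      (fun y => fderiv ℝ v y (EuclideanSpace.single i (1:ℝ))) x (EuclideanSpace.single i (1:ℝ)) * χ x := by
      congr 1
      ext x
      rw [e1 x, lap, Finset.sum_mul]
    rw [this, integral_finsetSum _ (fun i _ => hI1 i), Finset.sum_congr rfl (fun i _ => ibp i),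
      Finset.sum_neg_distrib, ← integral_finsetSum _ (fun i _ => hI2 i)]
    congr 2
    ext x
    by_cases h : 2 < ‖x‖
    · simp only [(hg x h).fderiv, (hχd x).fderiv]
      rw [EuclideanSpace.real_norm_sq_eq x, Finset.mul_sum, Finset.sum_mul]
      refine Finset.sum_congr rfl fun i _ => ?_
      simp [EuclideanSpace.inner_single_right]
      ring
    · have : deriv phi (‖x‖^2) = 0 := dphi_low (by nlinarith [norm_nonneg x])
      simp [(hχd x).fderiv, this]
  have hfr : Module.finrank ℝ (Euc (k+1)) = 2*(k+1) := by simp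
  haveI : Nontrivial (Euc (k+1)) := Module.nontrivial_of_finrank_pos (R := ℝ) (by rw [hfr]; omega)
  have hpol := integral_fun_norm_addHaar (volume : Measure (Euc (k+1)))
    (fun r : ℝ => 2 * a * ((r^2)⁻¹)^(k+1) * r^2 * deriv phi (r^2))
  rw [e2, hpol]
  have e3 : ∫ y in Ioi (0:ℝ), y ^ (Module.finrank ℝ (Euc (k+1)) - 1) •
      (2 * a * ((y^2)⁻¹)^(k+1) * y^2 * deriv phi (y^2)) = a * (-1) := by
    rw [← integral_dphi, ← integral_const_mul]
    refine setIntegral_congr_fun measurableSet_Ioi fun y hy => ?_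
    have hy0 : y ≠ 0 := (mem_Ioi.1 hy).ne'
    have : 2*(k+1)-1 = 2*k+1 := by omega
    simp only [hfr, this, smul_eq_mul]
    rw [inv_pow, ← pow_mul]
    field_simp
    try ring
  rw [e3]
  have hvol : (volume : Measure (Euc (k+1))).real (ball 0 1)
      = Real.pi^(k+1) / Nat.factorial (k+1) := by
    rw [Measure.real, InnerProductSpace.volume_ball_of_dim_even hfr]
    simp
    positivity
  rw [hvol, hfr, Nat.factorial_succ]
  have := Nat.factorial_pos k
  simp only [smul_eq_mul, nsmul_eq_mul]
  push_cast
  field_simp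

/-- **Total integral of `(−Δ)^m u₀` for `u₀ = log|x|` outside `B₂`.**
If `u₀ ∈ C^∞(ℝ^{2m})` equals `log|x|` for `|x| ≥ 2`, then `(−Δ)^m u₀` vanishes outside
`B₂` and `∫_{ℝ^{2m}} (−Δ)^m u₀ dx = −γ_{2m}`. -/
theorem statement14 (m : ℕ) (hm : 1 ≤ m)
    (u₀ : Euc m → ℝ) (hu₀smooth : ContDiff ℝ (⊤ : ℕ∞) u₀)
    (hu₀log : ∀ x : Euc m, 2 ≤ ‖x‖ → u₀ x = Real.log ‖x‖) :
    (∀ x : Euc m, 2 ≤ ‖x‖ → negLapPow m u₀ x = 0) ∧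
    Integrable (fun x => negLapPow m u₀ x) ∧
    (∫ x, negLapPow m u₀ x) = -(gamma2m m) := by
  obtain ⟨k, rfl⟩ : ∃ k, m = k + 1 := ⟨m - 1, by omega⟩
  have hgrad := grad_negLapPow rfl u₀ hu₀log k le_rfl
  have hl : ∀ x : Euc (k+1), 2 < ‖x‖ → lap (negLapPow k u₀) x = 0 := by
    intro x hx
    rw [lap_of_grad _ _ k hgrad x hx]
    push_cast
    ring
  have hcont : Continuous (negLapPow (k+1) u₀) := (contDiff_negLapPow hu₀smooth _).continuous
  have hvan : ∀ x : Euc (k+1), 2 ≤ ‖x‖ → negLapPow (k+1) u₀ x = 0 := by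
    intro x hx
    have h1 : Tendsto (fun t : ℝ => negLapPow (k+1) u₀ (t • x)) (𝓝[>] 1)
        (𝓝 (negLapPow (k+1) u₀ x)) := by
      have : Continuous (fun t : ℝ => negLapPow (k+1) u₀ (t • x)) := by fun_prop
      have h := this.tendsto 1
      rw [one_smul] at h
      exact h.mono_left nhdsWithin_le_nhds
    refine tendsto_nhds_unique h1 (tendsto_const_nhds.congr' ?_)
    filter_upwards [self_mem_nhdsWithin] with t ht
    have ht' : (1:ℝ) < t := ht
    rw [negLapPow_succ']
    simp only
    rw [hl, neg_zero]
    rw [norm_smul, Real.norm_of_nonneg (by linarith)]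
    nlinarith
  refine ⟨hvan, ?_, ?_⟩
  · refine hcont.integrable_of_hasCompactSupport ?_
    refine HasCompactSupport.intro (isCompact_closedBall (0 : Euc (k+1)) 2) ?_
    intro x hx
    simp only [mem_closedBall, dist_zero_right, not_le] at hx
    exact hvan x hx.le
  · rw [negLapPow_succ', integral_neg, integral_lap _ (contDiff_negLapPow hu₀smooth _) _ hgrad hl,
      const_eq, Nat.descFactorial_self]
    have := Nat.factorial_pos k
    field_simp
end
end

section
/- Let m ≥ 1 be an integer. The function x ↦ log(1/|x|) is locally integrable on ℝ^{2m} and satisfies (−Δ)^m log(1/|x|) = γ_{2m} δ₀ in the sense of distributions, i.e. for every φ ∈ C_c^∞(ℝ^{2m}) one has ∫_{ℝ^{2m}} log(1/|x|) (−Δ)^m φ(x) dx = γ_{2m} φ(0), where γ_{2m} = (2m−1)!·vol(S^{2m})/2. -/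
noncomputable section

open MeasureTheory Real Filter Topology Metric Set Bornology

/-- Coefficients of `(−Δ)^{j+1}` applied to `-(1/2) log(|x|²+e)`. -/
def coefC (M : ℝ) (j i : ℕ) : ℝ :=
  2 ^ (2*j+1) * (Nat.factorial (j+i) : ℝ) * (Nat.choose (j+1) i : ℝ) *
    ∏ l ∈ Finset.Ico (i+1) (j+2), (M - (l:ℝ))

/-- The radial profile of `(−Δ)^j (-(1/2) log(|x|²+e))`, as a function of `t = |x|²+e`. -/
def prof (M e : ℝ) : ℕ → ℝ → ℝ
  | 0, t => -(1/2) * Real.log t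
  | (j+1), t => ∑ i ∈ Finset.range (j+2), coefC M j i * e^i * (t^(j+1+i))⁻¹

def prof' (M e : ℝ) : ℕ → ℝ → ℝ
  | 0, t => -(1/2) * t⁻¹
  | (j+1), t => ∑ i ∈ Finset.range (j+2), coefC M j i * e^i * (-((j+1+i : ℕ):ℝ) * (t^(j+1+i+1))⁻¹)

def prof'' (M e : ℝ) : ℕ → ℝ → ℝ
  | 0, t => -(1/2) * (-(t^2)⁻¹)
  | (j+1), t => ∑ i ∈ Finset.range (j+2), coefC M j i * e^i *
      (((j+1+i : ℕ):ℝ) * ((j+1+i+1 : ℕ):ℝ) * (t^(j+1+i+2))⁻¹)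

lemma hasDerivAt_inv_pow (k : ℕ) {t : ℝ} (ht : 0 < t) :
    HasDerivAt (fun t : ℝ => (t^k)⁻¹) (-(k:ℝ) * (t^(k+1))⁻¹) t := by
  have h := (hasDerivAt_pow k t).inv (by positivity)
  refine h.congr_deriv ?_
  rcases k with _ | k
  · simp
  · simp only [Nat.add_sub_cancel]
    field_simp
    ring

lemma prof_deriv (M e : ℝ) (j : ℕ) {t : ℝ} (ht : 0 < t) :
    HasDerivAt (prof M e j) (prof' M e j t) t := by
  rcases j with _ | j
  · exact (Real.hasDerivAt_log ht.ne').const_mul _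
  · show HasDerivAt (fun t => ∑ i ∈ Finset.range (j+2), coefC M j i * e^i * (t^(j+1+i))⁻¹) _ t
    exact HasDerivAt.fun_sum fun i _ => (hasDerivAt_inv_pow (j+1+i) ht).const_mul _

lemma prof'_deriv (M e : ℝ) (j : ℕ) {t : ℝ} (ht : 0 < t) :
    HasDerivAt (prof' M e j) (prof'' M e j t) t := by
  rcases j with _ | j
  · exact (hasDerivAt_inv ht.ne').const_mul _
  · show HasDerivAt (fun t => ∑ i ∈ Finset.range (j+2), coefC M j i * e^i *
      (-((j+1+i : ℕ):ℝ) * (t^(j+1+i+1))⁻¹)) _ t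
    refine (HasDerivAt.fun_sum fun i _ =>
      ((hasDerivAt_inv_pow (j+1+i+1) ht).const_mul (-((j+1+i : ℕ):ℝ))).const_mul _).congr_deriv ?_
    show _ = ∑ i ∈ Finset.range (j+2), coefC M j i * e^i *
      (((j+1+i : ℕ):ℝ) * ((j+1+i+1 : ℕ):ℝ) * (t^(j+1+i+2))⁻¹)
    refine Finset.sum_congr rfl fun i _ => ?_
    ring

lemma coefC_zero (M : ℝ) (j : ℕ) :
    coefC M (j+1) 0 = 4 * (j+1) * (M - (j+1) - 1) * coefC M j 0 := by
  simp only [coefC, Nat.choose_zero_right]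
  rw [Finset.prod_Ico_succ_top (by omega : 0+1 ≤ j+1+1)]
  simp only [add_zero, Nat.factorial_succ]
  push_cast
  ring

lemma coefC_succ (M : ℝ) (j i : ℕ) (hi : i ≤ j+1) :
    coefC M (j+1) (i+1) = 4 * (j+1+(i+1)) * (M - (j+1+(i+1)) - 1) * coefC M j (i+1)
      + 4 * (j+1+i) * (j+1+i+1) * coefC M j i := by
  rcases Nat.lt_or_ge i (j+1) with h | h
  · have hch : ((Nat.choose (j+1) (i+1) : ℕ):ℝ) * (i+1) = (Nat.choose (j+1) i : ℕ) * (j+1-i) := by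
      have := Nat.choose_succ_right_eq (j+1) i
      have h2 : ((j+1-i : ℕ):ℝ) = j+1-i := by rw [Nat.cast_sub hi]; push_cast; ring
      rw [← h2]
      exact_mod_cast this
    have hpas : ((Nat.choose (j+1+1) (i+1) : ℕ):ℝ)
        = (Nat.choose (j+1) i : ℕ) + (Nat.choose (j+1) (i+1) : ℕ) := by
      rw [Nat.choose_succ_succ]; push_cast; ring
    simp only [coefC]
    rw [hpas, Finset.prod_Ico_succ_top (by omega : i+1+1 ≤ j+1+1),
      Finset.prod_eq_prod_Ico_succ_bot (by omega : i+1 < j+2)]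
    have f1 : ((j+1+(i+1)).factorial : ℝ) = (j+i+2)*(j+i+1)*((j+i).factorial : ℝ) := by
      rw [show j+1+(i+1) = (j+i)+1+1 by ring, Nat.factorial_succ, Nat.factorial_succ]
      push_cast; ring
    have f2 : ((j+(i+1)).factorial : ℝ) = (j+i+1)*((j+i).factorial : ℝ) := by
      rw [show j+(i+1) = (j+i)+1 by ring, Nat.factorial_succ]
      push_cast; ring
    rw [f1, f2]
    set P := ∏ l ∈ Finset.Ico (i+1+1) (j+2), (M - (l:ℝ))
    set A := ((Nat.choose (j+1) i : ℕ):ℝ)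
    set B := ((Nat.choose (j+1) (i+1) : ℕ):ℝ)
    set F := ((j+i).factorial : ℝ)
    have e2 : (2:ℝ)^(2*(j+1)+1) = 4 * 2^(2*j+1) := by ring
    rw [e2]
    push_cast
    linear_combination (4 * 2^(2*j+1) * (j+i+2)*(j+i+1) * F * P) * hch
  · have : i = j+1 := by omega
    subst this
    simp only [coefC]
    simp only [Nat.choose_self, Nat.choose_succ_self]
    have f1 : ((j+1+(j+1+1)).factorial : ℝ) = (j+1+(j+1)+1)*(j+1+(j+1))*((j+(j+1)).factorial : ℝ) := by
      rw [show j+1+(j+1+1) = (j+(j+1))+1+1 by ring, Nat.factorial_succ, Nat.factorial_succ]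
      push_cast; ring
    rw [f1]
    simp
    ring

lemma prof_step (M e : ℝ) (j : ℕ) {t : ℝ} (ht : 0 < t) :
    -(4 * (t - e) * prof'' M e j t + 4 * M * prof' M e j t) = prof M e (j+1) t := by
  rcases j with _ | j
  · simp only [prof, prof', prof'', coefC, Finset.sum_range_succ]
    simp
    field_simp
    ring
  · simp only [prof, prof', prof'']
    rw [Finset.sum_range_succ' _ (j+2), coefC_zero]
    have h1 : ∑ k ∈ Finset.range (j + 2), coefC M (j + 1) (k + 1) * e ^ (k + 1) * (t ^ (j + 1 + 1 + (k + 1)))⁻¹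
      = ∑ k ∈ Finset.range (j + 2), (4 * (j+1+(k+1)) * (M - (j+1+(k+1)) - 1) * coefC M j (k+1)) * e ^ (k + 1) * (t ^ (j + 1 + 1 + (k + 1)))⁻¹
      + ∑ k ∈ Finset.range (j + 2), (4 * (j+1+k) * (j+1+k+1) * coefC M j k) * e ^ (k + 1) * (t ^ (j + 1 + 1 + (k + 1)))⁻¹ := by
      rw [← Finset.sum_add_distrib]
      refine Finset.sum_congr rfl fun k hk => ?_
      rw [coefC_succ M j k (by have := Finset.mem_range.1 hk; omega)]
      ring
    have h2 := Finset.sum_range_succ' (fun k : ℕ => (4 * ((j:ℝ)+1+k) * (M - (j+1+k) - 1) * coefC M j k) * e ^ k * (t ^ (j + 1 + 1 + k))⁻¹) (j+2)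
    have h3 := Finset.sum_range_succ (fun k : ℕ => (4 * ((j:ℝ)+1+k) * (M - (j+1+k) - 1) * coefC M j k) * e ^ k * (t ^ (j + 1 + 1 + k))⁻¹) (j+2)
    have h4 : coefC M j (j+2) = 0 := by simp [coefC]
    rw [h2] at h3
    push_cast at h3
    simp only [h4, mul_zero, zero_mul, add_zero] at h3
    rw [h1]
    have h5 : -(4 * (t - e) * ∑ i ∈ Finset.range (j+2), coefC M j i * e^i *
      (((j+1+i : ℕ):ℝ) * ((j+1+i+1 : ℕ):ℝ) * (t^(j+1+i+2))⁻¹) + 4 * M * ∑ i ∈ Finset.range (j+2), coefC M j i * e^i * (-((j+1+i : ℕ):ℝ) * (t^(j+1+i+1))⁻¹))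
      = ∑ k ∈ Finset.range (j + 2), (4 * ((j:ℝ)+1+k) * (M - (j+1+k) - 1) * coefC M j k) * e ^ k * (t ^ (j + 1 + 1 + k))⁻¹
      + ∑ k ∈ Finset.range (j + 2), (4 * (j+1+k) * (j+1+k+1) * coefC M j k) * e ^ (k + 1) * (t ^ (j + 1 + 1 + (k + 1)))⁻¹ := by
      rw [Finset.mul_sum, Finset.mul_sum, ← Finset.sum_add_distrib, ← Finset.sum_add_distrib, ← Finset.sum_neg_distrib]
      refine Finset.sum_congr rfl fun k hk => ?_
      push_cast
      have a1 : (t^(j+1+k+1))⁻¹ = t * (t^(j+1+k+2))⁻¹ := by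
        rw [pow_succ t (j+1+k+1)]
        field_simp
      rw [show j+1+1+k = j+1+k+1 by ring, show j+1+1+(k+1) = j+1+k+2 by ring, a1]
      ring
    rw [h5, ← h3]
    simp only [add_zero]
    ring

lemma prof_top (m : ℕ) (hm : 1 ≤ m) (e t : ℝ) :
    prof (m:ℝ) e m t = 2^(2*m-1) * (Nat.factorial (2*m-1) : ℝ) * (e^m * (t^(2*m))⁻¹) := by
  obtain ⟨j, rfl⟩ : ∃ j, m = j+1 := ⟨m-1, by omega⟩
  simp only [prof]
  rw [Finset.sum_range_succ, Finset.sum_eq_zero]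
  · rw [show 2*(j+1)-1 = 2*j+1 by omega, show 2*(j+1) = j+1+(j+1) by ring]
    simp only [coefC, show j+(j+1) = 2*j+1 by ring]
    simp
    ring
  · intro i hi
    have hi := Finset.mem_range.1 hi
    have : coefC ((j+1:ℕ):ℝ) j i = 0 := by
      unfold coefC
      rw [Finset.prod_eq_zero (i := j+1)]
      · simp
      · simp; omega
      · simp
    rw [this]; simp

lemma prof_contDiffAt (M e : ℝ) (j : ℕ) {t : ℝ} (ht : 0 < t) :
    ContDiffAt ℝ (⊤ : ℕ∞) (prof M e j) t := by
  rcases j with _ | j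
  · exact contDiffAt_const.mul (contDiffAt_id.log ht.ne')
  · show ContDiffAt ℝ (⊤ : ℕ∞) (fun t => ∑ i ∈ Finset.range (j+2), coefC M j i * e^i * (t^(j+1+i))⁻¹) t
    refine ContDiffAt.sum fun i _ => contDiffAt_const.mul ((contDiffAt_id.pow _).inv ?_)
    simp; exact fun h => absurd h ht.ne'

/-- Laplacian of a radial function. -/
lemma lap_radial {m : ℕ} (g g1 g2 : ℝ → ℝ) (e : ℝ) (he : 0 < e)
    (h1 : ∀ t, 0 < t → HasDerivAt g (g1 t) t) (h2 : ∀ t, 0 < t → HasDerivAt g1 (g2 t) t)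
    (x : Euc m) :
    lap (fun y : Euc m => g (‖y‖^2 + e)) x
      = 4 * ‖x‖^2 * g2 (‖x‖^2+e) + 4 * m * g1 (‖x‖^2+e) := by
  have hpos : ∀ y : Euc m, 0 < ‖y‖^2 + e := fun y => by positivity
  have hN : ∀ y : Euc m, HasFDerivAt (fun y : Euc m => ‖y‖^2 + e) (2 • (innerSL ℝ y)) y :=
    fun y => (hasStrictFDerivAt_norm_sq y).hasFDerivAt.add_const e
  have hd : ∀ (i : Fin (2*m)) (y : Euc m),
      fderiv ℝ (fun y : Euc m => g (‖y‖^2+e)) y (EuclideanSpace.single i (1:ℝ))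
        = g1 (‖y‖^2+e) * (2 * y i) := by
    intro i y
    have := (h1 _ (hpos y)).comp_hasFDerivAt y (hN y)
    have h3 := this.fderiv
    simp only [Function.comp_def] at h3
    rw [h3]
    simp [EuclideanSpace.inner_single_right]
  unfold lap
  simp only [hd]
  have hdd : ∀ (i : Fin (2*m)),
      fderiv ℝ (fun y : Euc m => g1 (‖y‖^2+e) * (2 * y i)) x (EuclideanSpace.single i (1:ℝ))
        = 4 * g2 (‖x‖^2+e) * (x i)^2 + 2 * g1 (‖x‖^2+e) := by
    intro i
    have ha := (h2 _ (hpos x)).comp_hasFDerivAt x (hN x)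
    have hb : HasFDerivAt (fun y : Euc m => 2 * y i)
      ((2:ℝ) • (EuclideanSpace.proj i : Euc m →L[ℝ] ℝ)) x :=
      ((EuclideanSpace.proj i : Euc m →L[ℝ] ℝ).hasFDerivAt).const_mul 2
    have h3 := (ha.mul hb).fderiv
    simp only [Function.comp_def] at h3
    change fderiv ℝ (fun y : Euc m => g1 (‖y‖^2+e) * (2 * y i)) x = _ at h3
    rw [h3]
    simp [EuclideanSpace.inner_single_right]
    ring
  simp only [hdd]
  rw [Finset.sum_add_distrib, ← Finset.mul_sum, ← EuclideanSpace.real_norm_sq_eq]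
  simp
  ring

lemma lap_prof {m : ℕ} (e : ℝ) (he : 0 < e) (j : ℕ) (x : Euc m) :
    -(lap (fun y : Euc m => prof m e j (‖y‖^2 + e)) x) = prof m e (j+1) (‖x‖^2+e) := by
  have hpos : 0 < ‖x‖^2 + e := by positivity
  rw [lap_radial (prof m e j) (prof' m e j) (prof'' m e j) e he
    (fun t ht => prof_deriv _ _ _ ht) (fun t ht => prof'_deriv _ _ _ ht), ← prof_step _ _ _ hpos]
  ring

lemma prof_smooth {m : ℕ} (e : ℝ) (he : 0 < e) (j : ℕ) :
    ContDiff ℝ (⊤ : ℕ∞) (fun y : Euc m => prof m e j (‖y‖^2 + e)) := by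
  rw [contDiff_iff_contDiffAt]
  intro y
  exact (prof_contDiffAt (m:ℝ) e j (t := ‖y‖^2+e) (by positivity)).comp y
    (((contDiff_norm_sq ℝ).add contDiff_const).contDiffAt)

lemma smooth_dir {m : ℕ} {f : Euc m → ℝ} (hf : ContDiff ℝ (⊤ : ℕ∞) f) (v : Euc m) :
    ContDiff ℝ (⊤ : ℕ∞) (fun y => fderiv ℝ f y v) :=
  (hf.fderiv_right (m := (⊤ : ℕ∞)) (by simp)).clm_apply contDiff_const

lemma smooth_lap {m : ℕ} {f : Euc m → ℝ} (hf : ContDiff ℝ (⊤ : ℕ∞) f) :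
    ContDiff ℝ (⊤ : ℕ∞) (lap f) := by
  unfold lap
  exact ContDiff.sum fun i _ => smooth_dir (smooth_dir hf _) _

lemma compact_dir {m : ℕ} {f : Euc m → ℝ} (hf : HasCompactSupport f) (v : Euc m) :
    HasCompactSupport (fun y => fderiv ℝ f y v) := hf.fderiv_apply ℝ v

lemma compact_lap {m : ℕ} {f : Euc m → ℝ} (hf : HasCompactSupport f) :
    HasCompactSupport (lap f) := by
  refine HasCompactSupport.of_support_subset_isCompact hf ?_
  intro x hx
  by_contra h
  apply hx
  unfold lap
  refine Finset.sum_eq_zero fun i _ => ?_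
  have h1 : x ∉ tsupport (fun y => fderiv ℝ (fun y => fderiv ℝ f y (EuclideanSpace.single i (1:ℝ))) y
      (EuclideanSpace.single i (1:ℝ))) := fun h2 =>
    h (tsupport_fderiv_apply_subset ℝ _ (tsupport_fderiv_apply_subset ℝ _ h2))
  exact image_eq_zero_of_notMem_tsupport (f := fun y => fderiv ℝ (fun y => fderiv ℝ f y
    (EuclideanSpace.single i (1:ℝ))) y (EuclideanSpace.single i (1:ℝ))) h1

lemma negLap_props {m : ℕ} {φ : Euc m → ℝ} (hf : ContDiff ℝ (⊤ : ℕ∞) φ)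
    (hc : HasCompactSupport φ) (k : ℕ) :
    ContDiff ℝ (⊤ : ℕ∞) (negLapPow k φ) ∧ HasCompactSupport (negLapPow k φ) := by
  induction k with
  | zero => exact ⟨hf, hc⟩
  | succ k ih =>
    have : negLapPow (k+1) φ = fun x => -(lap (negLapPow k φ) x) := by
      unfold negLapPow; rw [Function.iterate_succ_apply']
    rw [this]
    exact ⟨(smooth_lap ih.1).neg, (compact_lap ih.2).neg⟩

lemma integrable_mul_compact {m : ℕ} {u f : Euc m → ℝ} (hu : Continuous u) (hf : Continuous f)
    (hc : HasCompactSupport f) : Integrable (fun x => u x * f x) volume :=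
  (hu.mul hf).integrable_of_hasCompactSupport hc.mul_left

lemma ibp_dir {m : ℕ} {u f : Euc m → ℝ} (hu : ContDiff ℝ (⊤ : ℕ∞) u)
    (hf : ContDiff ℝ (⊤ : ℕ∞) f) (hc : HasCompactSupport f) (v : Euc m) :
    ∫ x, u x * fderiv ℝ f x v = - ∫ x, fderiv ℝ u x v * f x :=
  integral_mul_fderiv_eq_neg_fderiv_mul_of_integrable
    (integrable_mul_compact (smooth_dir hu v).continuous hf.continuous hc)
    (integrable_mul_compact hu.continuous (smooth_dir hf v).continuous (compact_dir hc v))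
    (integrable_mul_compact hu.continuous hf.continuous hc)
    (fun x _ => (hu.differentiable (by simp)) x)
    (fun x _ => (hf.differentiable (by simp)) x)

lemma ibp_lap {m : ℕ} {u f : Euc m → ℝ} (hu : ContDiff ℝ (⊤ : ℕ∞) u)
    (hf : ContDiff ℝ (⊤ : ℕ∞) f) (hc : HasCompactSupport f) :
    ∫ x, u x * lap f x = ∫ x, lap u x * f x := by
  unfold lap
  simp only [Finset.mul_sum, Finset.sum_mul]
  rw [integral_finsetSum, integral_finsetSum]
  · refine Finset.sum_congr rfl fun i _ => ?_
    rw [ibp_dir hu (smooth_dir hf _) (compact_dir hc _),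
      ibp_dir (smooth_dir hu _) hf hc, neg_neg]
  · intro i _
    exact integrable_mul_compact (smooth_dir (smooth_dir hu _) _).continuous hf.continuous hc
  · intro i _
    exact integrable_mul_compact hu.continuous (smooth_dir (smooth_dir hf _) _).continuous
      (compact_dir (compact_dir hc _) _)

lemma ibp_iter {m : ℕ} {φ : Euc m → ℝ} (hf : ContDiff ℝ (⊤ : ℕ∞) φ)
    (hc : HasCompactSupport φ) (e : ℝ) (he : 0 < e) (k : ℕ) : ∀ j : ℕ,
    ∫ x : Euc m, prof m e j (‖x‖^2+e) * negLapPow k φ x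
      = ∫ x : Euc m, prof m e (j+k) (‖x‖^2+e) * φ x := by
  induction k with
  | zero => intro j; rfl
  | succ k ih =>
    intro j
    have h : negLapPow (k+1) φ = fun x => -(lap (negLapPow k φ) x) := by
      unfold negLapPow; rw [Function.iterate_succ_apply']
    obtain ⟨p1, p2⟩ := negLap_props hf hc k
    rw [h]
    simp only [mul_neg]
    rw [integral_neg, ibp_lap (prof_smooth e he j) p1 p2, ← integral_neg]
    rw [show j + (k+1) = (j+1)+k by ring, ← ih (j+1)]
    simp only [← lap_prof e he j, neg_mul]

lemma smooth_identity {m : ℕ} (hm : 1 ≤ m) {φ : Euc m → ℝ} (hf : ContDiff ℝ (⊤ : ℕ∞) φ)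
    (hc : HasCompactSupport φ) (e : ℝ) (he : 0 < e) :
    ∫ x : Euc m, (-(1/2) * Real.log (‖x‖^2+e)) * negLapPow m φ x
      = 2^(2*m-1) * (Nat.factorial (2*m-1) : ℝ) *
        ∫ x : Euc m, (e^m * ((‖x‖^2+e)^(2*m))⁻¹) * φ x := by
  have := ibp_iter hf hc e he m 0
  rw [zero_add] at this
  simp only [prof_top m hm] at this
  rw [← integral_const_mul]
  simp only [← mul_assoc] at this ⊢
  exact this

/-- Radial integral. -/
lemma radial (b a : ℕ) : IntegrableOn (fun r : ℝ => r^(2*a+1) * ((1+r^2)^(a+b+2))⁻¹) (Ioi 0) ∧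
    ∫ r in Ioi (0:ℝ), r^(2*a+1) * ((1+r^2)^(a+b+2))⁻¹
      = (a.factorial : ℝ) * b.factorial / (2 * (a+b+1).factorial) := by
  have hlim : ∀ n : ℕ, n ≠ 0 → Tendsto (fun r : ℝ => ((1+r^2)^n)⁻¹) atTop (𝓝 0) := by
    intro n hn
    refine tendsto_inv_atTop_zero.comp ((tendsto_pow_atTop hn).comp ?_)
    exact tendsto_atTop_add_const_left _ _ (tendsto_pow_atTop two_ne_zero)
  induction a with
  | zero =>
    have hd : ∀ r ∈ Ici (0:ℝ), HasDerivAt (fun r : ℝ => -(1/(2*((b:ℝ)+1))) * ((1+r^2)^(b+1))⁻¹)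
        (r^(2*0+1) * ((1+r^2)^(0+b+2))⁻¹) r := by
      intro r _
      have h := ((hasDerivAt_inv_pow (b+1) (t := 1+r^2) (by positivity)).comp r
        ((hasDerivAt_pow 2 r).const_add 1)).const_mul (-(1/(2*((b:ℝ)+1))))
      refine h.congr_deriv ?_
      rw [show 0+b+2 = b+1+1 by ring]
      push_cast
      field_simp
    have hl : Tendsto (fun r : ℝ => -(1/(2*((b:ℝ)+1))) * ((1+r^2)^(b+1))⁻¹) atTop (𝓝 0) := by
      simpa using (hlim (b+1) (by omega)).const_mul (-(1/(2*((b:ℝ)+1))))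
    have hi := integrableOn_Ioi_deriv_of_nonneg' hd
      (fun r (hr : 0 < r) => by positivity) hl
    refine ⟨hi, ?_⟩
    rw [integral_Ioi_of_hasDerivAt_of_tendsto' hd hi hl]
    simp [Nat.factorial_succ]
    have : (b.factorial : ℝ) ≠ 0 := by positivity
    field_simp
  | succ a ih =>
    obtain ⟨i1, i2⟩ := ih
    have hi : IntegrableOn (fun r : ℝ => r^(2*(a+1)+1) * ((1+r^2)^(a+1+b+2))⁻¹) (Ioi 0) := by
      refine Integrable.mono i1 ?_ ?_
      · refine Continuous.aestronglyMeasurable ?_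
        refine Continuous.mul (by fun_prop) (Continuous.inv₀ (by fun_prop) fun r => by positivity)
      · refine (ae_restrict_iff' measurableSet_Ioi).2 (Eventually.of_forall fun r (hr : 0 < r) => ?_)
        rw [Real.norm_of_nonneg (by positivity), Real.norm_of_nonneg (by positivity)]
        rw [show 2*(a+1)+1 = (2*a+1)+2 by ring, show a+1+b+2 = (a+b+2)+1 by ring, pow_add,
          pow_succ (1+r^2), mul_inv, mul_assoc]
        refine mul_le_mul_of_nonneg_left ?_ (by positivity)
        have : r^2 * (1+r^2)⁻¹ ≤ 1 := by
          rw [← div_eq_mul_inv, div_le_one (by positivity)]; linarith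
        calc r^2 * (((1+r^2)^(a+b+2))⁻¹ * (1+r^2)⁻¹) = ((1+r^2)^(a+b+2))⁻¹ * (r^2 * (1+r^2)⁻¹) := by ring
          _ ≤ ((1+r^2)^(a+b+2))⁻¹ * 1 := mul_le_mul_of_nonneg_left this (by positivity)
          _ = _ := mul_one _
    refine ⟨hi, ?_⟩
    have hd : ∀ r ∈ Ici (0:ℝ), HasDerivAt (fun r : ℝ => r^(2*a+2) * ((1+r^2)^(a+b+2))⁻¹)
        ((2*a+2) * (r^(2*a+1) * ((1+r^2)^(a+b+2))⁻¹)
          - 2*(a+b+2) * (r^(2*(a+1)+1) * ((1+r^2)^(a+1+b+2))⁻¹)) r := by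
      intro r _
      have h := (hasDerivAt_pow (2*a+2) r).mul
        ((hasDerivAt_inv_pow (a+b+2) (t := 1+r^2) (by positivity)).comp r
        ((hasDerivAt_pow 2 r).const_add 1))
      refine h.congr_deriv ?_
      rw [show a+1+b+2 = a+b+2+1 by ring]
      push_cast
      simp only [Function.comp_def]
      ring
    have hl : Tendsto (fun r : ℝ => r^(2*a+2) * ((1+r^2)^(a+b+2))⁻¹) atTop (𝓝 0) := by
      refine squeeze_zero (fun r => ?_) (fun r => ?_) (hlim (b+1) (by omega))
      · rw [show 2*a+2 = 2*(a+1) by ring, pow_mul]; positivity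
      rw [show a+b+2 = (a+1)+(b+1) by ring, pow_add (1+r^2), mul_inv, ← mul_assoc,
        show 2*a+2 = 2*(a+1) by ring, pow_mul]
      have : (r^2)^(a+1) * ((1+r^2)^(a+1))⁻¹ ≤ 1 := by
        rw [← div_eq_mul_inv, div_le_one (by positivity)]
        exact pow_le_pow_left₀ (by positivity) (by linarith) _
      exact mul_le_of_le_one_left (by positivity) this
    have key := integral_Ioi_of_hasDerivAt_of_tendsto' hd
      ((i1.const_mul _).sub (hi.const_mul _)) hl
    rw [integral_sub (i1.const_mul _) (hi.const_mul _), integral_const_mul, integral_const_mul,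
      i2] at key
    simp only [ne_eq, Nat.add_eq_zero_iff, OfNat.ofNat_ne_zero, and_false, not_false_eq_true,
      zero_pow, zero_mul, sub_zero] at key
    have f1 : ((a+1+b+1).factorial : ℝ) = (a+b+2) * ((a+b+1).factorial : ℝ) := by
      rw [show a+1+b+1 = a+b+1+1 by ring, Nat.factorial_succ]; push_cast; ring
    have f2 : ((a+1).factorial : ℝ) = (a+1) * (a.factorial : ℝ) := by
      rw [Nat.factorial_succ]; push_cast; ring
    rw [f1, f2]
    have hF : ((a+b+1).factorial : ℝ) ≠ 0 := by positivity
    have hab : (a:ℝ)+b+2 ≠ 0 := by positivity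
    field_simp at key ⊢
    linarith

lemma log_locint (m : ℕ) (hm : 1 ≤ m) :
    LocallyIntegrable (fun x : Euc m => Real.log (1 / ‖x‖)) volume := by
  have : Nonempty (Fin (2*m)) := ⟨⟨0, by omega⟩⟩
  intro x
  refine ⟨ball 0 (‖x‖+1), isOpen_ball.mem_nhds (by simp), ?_⟩
  rw [integrableOn_fun_norm_addHaar volume (f := fun r => Real.log (1/r))]
  have h : IntervalIntegrable (fun y : ℝ => y ^ (Module.finrank ℝ (Euc m) - 1) * Real.log y)
      volume 0 (‖x‖+1) :=
    intervalIntegral.intervalIntegrable_log'.continuousOn_mul (by fun_prop)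
  have h2 := (h.1.mono_set Ioo_subset_Ioc_self).neg
  refine h2.congr (Eventually.of_forall fun y => ?_)
  simp

lemma bubble_integrable (m : ℕ) (hm : 1 ≤ m) :
    Integrable (fun x : Euc m => ((1+‖x‖^2)^(2*m))⁻¹) volume := by
  have : Nonempty (Fin (2*m)) := ⟨⟨0, by omega⟩⟩
  rw [integrable_fun_norm_addHaar volume (f := fun r => ((1+r^2)^(2*m))⁻¹)]
  have := (radial (m-1) (m-1)).1
  rw [show m-1+(m-1)+2 = 2*m by omega, show 2*(m-1)+1 = 2*m-1 by omega] at this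
  simpa using this

lemma bubble_integral (m : ℕ) (hm : 1 ≤ m) :
    ∫ x : Euc m, ((1+‖x‖^2)^(2*m))⁻¹
      = Real.pi^m * ((m-1).factorial : ℝ) / ((2*m-1).factorial : ℝ) := by
  have : Nonempty (Fin (2*m)) := ⟨⟨0, by omega⟩⟩
  rw [integral_fun_norm_addHaar volume (fun r => ((1+r^2)^(2*m))⁻¹)]
  have := (radial (m-1) (m-1)).2
  rw [show m-1+(m-1)+2 = 2*m by omega, show 2*(m-1)+1 = 2*m-1 by omega,
    show m-1+(m-1)+1 = 2*m-1 by omega] at this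
  simp only [finrank_euclideanSpace, Fintype.card_fin, smul_eq_mul, this]
  rw [Measure.real, EuclideanSpace.volume_ball]
  simp only [Fintype.card_fin, ENNReal.ofReal_one, one_pow, one_mul]
  rw [ENNReal.toReal_ofReal (by positivity), pow_mul, Real.sq_sqrt Real.pi_pos.le]
  have hG : Real.Gamma (((2*m : ℕ):ℝ)/2 + 1) = m * ((m-1).factorial : ℝ) := by
    rw [show ((2*m : ℕ):ℝ)/2 = (m:ℝ) by push_cast; ring, Real.Gamma_nat_eq_factorial]
    obtain ⟨j, rfl⟩ : ∃ j, m = j+1 := ⟨m-1, by omega⟩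
    rw [Nat.factorial_succ]; push_cast; simp
  rw [hG]
  have h1 : ((m-1).factorial : ℝ) ≠ 0 := by positivity
  have h2 : ((2*m-1).factorial : ℝ) ≠ 0 := by positivity
  have h3 : (m:ℝ) ≠ 0 := by positivity
  simp only [nsmul_eq_mul]
  push_cast
  field_simp

lemma gamma2m_eq (m : ℕ) (hm : 1 ≤ m) :
    gamma2m m = 2^(2*m-1) * (Nat.factorial (2*m-1) : ℝ) *
      (Real.pi^m * ((m-1).factorial : ℝ) / ((2*m-1).factorial : ℝ)) := by
  obtain ⟨j, rfl⟩ : ∃ j, m = j+1 := ⟨m-1, by omega⟩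
  have h := Real.Gamma_mul_Gamma_add_half ((j:ℝ)+1)
  have hG1 : Real.Gamma ((j:ℝ)+1) = (j.factorial : ℝ) := Real.Gamma_nat_eq_factorial j
  have hG2 : Real.Gamma (2*((j:ℝ)+1)) = ((2*j+1).factorial : ℝ) := by
    rw [← Real.Gamma_nat_eq_factorial]; congr 1; push_cast; ring
  have hp : (2:ℝ)^(1-2*((j:ℝ)+1)) = (2^(2*j+1))⁻¹ := by
    rw [show 1-2*((j:ℝ)+1) = -((2*j+1 : ℕ):ℝ) by push_cast; ring,
      Real.rpow_neg (by norm_num), Real.rpow_natCast]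
  rw [hG1, hG2, hp] at h
  have hpi : Real.pi^((j:ℝ)+1+1/2) = Real.pi^(j+1) * √Real.pi := by
    rw [Real.rpow_add Real.pi_pos, Real.sqrt_eq_rpow,
      show (j:ℝ)+1 = ((j+1 : ℕ):ℝ) by push_cast; ring, Real.rpow_natCast]
  unfold gamma2m Lambda1 sphereVol
  have e1 : (((2*(j+1) : ℕ):ℝ)+1)/2 = (j:ℝ)+1+1/2 := by push_cast; ring
  rw [e1, hpi, show 2*(j+1)-1 = 2*j+1 by omega, show j+1-1 = j by omega]
  have hGp : Real.Gamma ((j:ℝ)+1+1/2) ≠ 0 := (Real.Gamma_pos_of_pos (by positivity)).ne'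
  have h2 : ((2*j+1).factorial : ℝ) ≠ 0 := by positivity
  have h3 : (j.factorial : ℝ) ≠ 0 := by positivity
  generalize Real.Gamma ((j:ℝ)+1+1/2) = G at *
  have h4 : (2:ℝ)^(2*j+1) ≠ 0 := by positivity
  generalize (2:ℝ)^(2*j+1) = T at *
  generalize ((2*j+1).factorial : ℝ) = A at *
  field_simp at h ⊢
  linear_combination -h

lemma scale_integral {m : ℕ} (φ : Euc m → ℝ) (s : ℝ) (hs : 0 < s) :
    ∫ x : Euc m, ((s^2)^m * ((‖x‖^2+s^2)^(2*m))⁻¹) * φ x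
      = ∫ x : Euc m, ((1+‖x‖^2)^(2*m))⁻¹ * φ (s • x) := by
  have h := Measure.integral_comp_smul (volume : Measure (Euc m))
    (fun x : Euc m => ((s^2)^m * ((‖x‖^2+s^2)^(2*m))⁻¹) * φ x) s
  have hn : (0:ℝ) < s^(2*m) := by positivity
  simp only [finrank_euclideanSpace, Fintype.card_fin, smul_eq_mul] at h
  rw [abs_of_pos (inv_pos.2 hn), eq_inv_mul_iff_mul_eq₀ hn.ne', ← integral_const_mul] at h
  rw [← h]
  refine integral_congr_ae (Eventually.of_forall fun x => ?_)
  simp only [norm_smul, Real.norm_of_nonneg hs.le]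
  rw [show (s*‖x‖)^2+s^2 = s^2*(1+‖x‖^2) by ring, mul_pow (s^2), ← pow_mul, ← pow_mul]
  field_simp
  ring

lemma rhs_limit {m : ℕ} (hm : 1 ≤ m) {φ : Euc m → ℝ} (hf : Continuous φ)
    (hc : HasCompactSupport φ) :
    Tendsto (fun s : ℝ => ∫ x : Euc m, ((1+‖x‖^2)^(2*m))⁻¹ * φ (s • x)) (𝓝[>] 0)
      (𝓝 (∫ x : Euc m, ((1+‖x‖^2)^(2*m))⁻¹ * φ 0)) := by
  obtain ⟨C, hC⟩ := hc.exists_bound_of_continuous hf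
  refine tendsto_integral_filter_of_dominated_convergence
    (fun x => ((1+‖x‖^2)^(2*m))⁻¹ * C) ?_ ?_ ((bubble_integrable m hm).mul_const C) ?_
  · refine Eventually.of_forall fun s => Continuous.aestronglyMeasurable ?_
    refine Continuous.mul (Continuous.inv₀ (by fun_prop) fun r => by positivity) (by fun_prop)
  · refine Eventually.of_forall fun s => Eventually.of_forall fun x => ?_
    rw [norm_mul, Real.norm_of_nonneg (by positivity)]
    exact mul_le_mul_of_nonneg_left (hC _) (by positivity)
  · refine Eventually.of_forall fun x => Tendsto.const_mul _ ?_
    have : Continuous fun s : ℝ => φ (s • x) := by fun_prop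
    have h := this.tendsto 0
    simp only [zero_smul] at h
    exact h.mono_left nhdsWithin_le_nhds

lemma lhs_limit {m : ℕ} (hm : 1 ≤ m) {ψ : Euc m → ℝ} (hf : Continuous ψ)
    (hc : HasCompactSupport ψ) :
    Tendsto (fun s : ℝ => ∫ x : Euc m, (-(1/2) * Real.log (‖x‖^2+s^2)) * ψ x) (𝓝[>] 0)
      (𝓝 (∫ x : Euc m, Real.log (1/‖x‖) * ψ x)) := by
  have : Nonempty (Fin (2*m)) := ⟨⟨0, by omega⟩⟩
  have hne : ∀ᵐ x : Euc m, x ≠ 0 := by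
    rw [ae_iff]; simp
  have hI1 : Integrable (fun x : Euc m => Real.log (1/‖x‖) * ψ x) volume := by
    simpa [smul_eq_mul, mul_comm] using
      (log_locint m hm).integrable_smul_left_of_hasCompactSupport hf hc
  have hI2 : Integrable (fun x : Euc m => Real.log (‖x‖^2+1) * ψ x) volume :=
    integrable_mul_compact (Continuous.log (by fun_prop) fun x => by positivity) hf hc
  refine tendsto_integral_filter_of_dominated_convergence
    (fun x => ‖Real.log (1/‖x‖) * ψ x‖ + ‖Real.log (‖x‖^2+1) * ψ x‖) ?_ ?_ (hI1.norm.add hI2.norm) ?_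
  · filter_upwards [self_mem_nhdsWithin] with s hs
    have hs : 0 < s := hs
    refine Continuous.aestronglyMeasurable ?_
    exact (continuous_const.mul (Continuous.log (by fun_prop) fun x => by positivity)).mul hf
  · have h1 : ∀ᶠ s : ℝ in 𝓝[>] 0, s < 1 := nhdsWithin_le_nhds (Iio_mem_nhds one_pos)
    filter_upwards [self_mem_nhdsWithin, h1] with s hs hs1
    have hs : 0 < s := hs
    filter_upwards [hne] with x hx
    have hx : 0 < ‖x‖ := norm_pos_iff.2 hx
    rw [norm_mul _ (ψ x), norm_mul _ (ψ x), norm_mul _ (ψ x), ← add_mul]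
    refine mul_le_mul_of_nonneg_right ?_ (norm_nonneg _)
    have l1 : Real.log (‖x‖^2) ≤ Real.log (‖x‖^2+s^2) :=
      Real.log_le_log (by positivity) (by nlinarith)
    have l2 : Real.log (‖x‖^2+s^2) ≤ Real.log (‖x‖^2+1) :=
      Real.log_le_log (by positivity) (by nlinarith)
    rw [Real.log_pow] at l1
    push_cast at l1
    rw [one_div ‖x‖, Real.log_inv]
    simp only [Real.norm_eq_abs, abs_neg]
    have a1 := neg_abs_le (Real.log ‖x‖)
    have a2 := le_abs_self (Real.log (‖x‖^2+1))
    have a3 := abs_nonneg (Real.log (‖x‖^2+1))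
    have a4 := abs_nonneg (Real.log ‖x‖)
    rw [abs_le]
    constructor <;> linarith
  · filter_upwards [hne] with x hx
    have hx : 0 < ‖x‖ := norm_pos_iff.2 hx
    refine Tendsto.mul_const _ ?_
    have hcont : ContinuousAt (fun s : ℝ => -(1/2) * Real.log (‖x‖^2+s^2)) 0 := by
      refine continuousAt_const.mul (ContinuousAt.log (by fun_prop) ?_)
      positivity
    have h := hcont.tendsto
    have e : -(1/2) * Real.log (‖x‖^2+0^2) = Real.log (1/‖x‖) := by
      rw [one_div ‖x‖, Real.log_inv, show ‖x‖^2+(0:ℝ)^2 = ‖x‖^2 by ring, Real.log_pow]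
      push_cast; ring
    simp only [e] at h
    exact h.mono_left nhdsWithin_le_nhds

/-- **Fundamental solution:** `log(1/|x|)` is locally integrable on `ℝ^{2m}` and
`(−Δ)^m log(1/|x|) = γ_{2m} δ₀` in the sense of distributions. -/
theorem statement15 (m : ℕ) (hm : 1 ≤ m) :
    LocallyIntegrable (fun x : Euc m => Real.log (1 / ‖x‖)) volume ∧
    ∀ φ : Euc m → ℝ, ContDiff ℝ (⊤ : ℕ∞) φ → HasCompactSupport φ →
      (∫ x : Euc m, Real.log (1 / ‖x‖) * negLapPow m φ x) = gamma2m m * φ 0 := by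
  refine ⟨log_locint m hm, fun φ hf hc => ?_⟩
  obtain ⟨p1, p2⟩ := negLap_props hf hc m
  have hL := lhs_limit hm p1.continuous p2
  have hR := (rhs_limit hm hf.continuous hc).const_mul
    (2^(2*m-1) * (Nat.factorial (2*m-1) : ℝ))
  have hEq : (fun s : ℝ => ∫ x : Euc m, (-(1/2) * Real.log (‖x‖^2+s^2)) * negLapPow m φ x)
      =ᶠ[𝓝[>] 0] fun s : ℝ => 2^(2*m-1) * (Nat.factorial (2*m-1) : ℝ) *
        ∫ x : Euc m, ((1+‖x‖^2)^(2*m))⁻¹ * φ (s • x) := by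
    filter_upwards [self_mem_nhdsWithin] with s hs
    have hs : 0 < s := hs
    rw [smooth_identity hm hf hc (s^2) (by positivity), scale_integral φ s hs]
  have h := tendsto_nhds_unique (hL.congr' hEq) hR
  rw [h, integral_mul_const, bubble_integral m hm, gamma2m_eq m hm]
  ring
end
end
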